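/- Let n ≥ 2 be an integer. There exists a spherical code C in ℝ^n with maximal inner product 1/2 such that |C| ≥ 2·B((n−1)/2, 1/2) / B(3/4; (n−1)/2, 1/2). -/

import Mathlib

open scoped RealInnerProductSpace

/-- The incomplete beta function `B(x; y, z) = ∫_0^x t^(y-1) (1-t)^(z-1) dt`;
the (complete) beta function is `B(y, z) = incBeta 1 y z`. -/
noncomputable def incBeta (x y z : ℝ) : ℝ :=
  ∫ t in (0:ℝ)..x, t ^ (y - 1) * (1 - t) ^ (z - 1)

/-- A spherical code in `ℝ^n` with maximal inner product `t`: a finite set of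
unit vectors whose pairwise inner products are at most `t`. -/
def IsSphericalCode (n : ℕ) (t : ℝ) (C : Finset (EuclideanSpace ℝ (Fin n))) : Prop :=
  (∀ x ∈ C, ‖x‖ = 1) ∧ ∀ x ∈ C, ∀ y ∈ C, x ≠ y → ⟪x, y⟫ ≤ t

open MeasureTheory Set Metric
open scoped ENNReal NNReal

section Polar

variable {E : Type*} [NormedAddCommGroup E] [NormedSpace ℝ E] [FiniteDimensional ℝ E]
  [MeasurableSpace E] [BorelSpace E] [Nontrivial E]

theorem lintegral_fun_norm_addHaar (μ : Measure E) [μ.IsAddHaarMeasure] {f : ℝ → ℝ≥0∞}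
    (hf : Measurable f) :
    ∫⁻ x, f ‖x‖ ∂μ = μ.toSphere univ *
      ∫⁻ r in Ioi (0 : ℝ), ENNReal.ofReal (r ^ (Module.finrank ℝ E - 1)) * f r :=
  calc
    ∫⁻ x, f ‖x‖ ∂μ = ∫⁻ x : ({(0)}ᶜ : Set E), f ‖x.1‖ ∂(μ.comap (↑)) := by
      rw [lintegral_subtype_comap (measurableSet_singleton _).compl fun x ↦ f ‖x‖,
        restrict_compl_singleton]
    _ = ∫⁻ x, f x.2 ∂μ.toSphere.prod (.volumeIoiPow (Module.finrank ℝ E - 1)) := by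
      simpa using μ.measurePreserving_homeomorphUnitSphereProd.lintegral_comp
        (f := fun p ↦ f p.2) (hf.comp (measurable_subtype_coe.comp measurable_snd))
    _ = μ.toSphere univ * ∫⁻ x : Ioi (0 : ℝ), f x ∂.volumeIoiPow (Module.finrank ℝ E - 1) := by
      rw [lintegral_prod _ (by fun_prop)]
      simp only [lintegral_const, mul_comm]
    _ = _ := by
      rw [Measure.volumeIoiPow, lintegral_withDensity_eq_lintegral_mul _ (by fun_prop) (by fun_prop)]
      congr 1
      exact lintegral_subtype_comap measurableSet_Ioi
        fun r ↦ ENNReal.ofReal (r ^ (Module.finrank ℝ E - 1)) * f r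

end Polar

section Axis

variable {E F : Type*} [NormedAddCommGroup E] [InnerProductSpace ℝ E] [FiniteDimensional ℝ E]
  [NormedAddCommGroup F] [InnerProductSpace ℝ F] [FiniteDimensional ℝ F]

theorem exists_linearIsometryEquiv_apply_eq {x : E} {y : F} (hxy : ‖x‖ = ‖y‖)
    (h : Module.finrank ℝ E = Module.finrank ℝ F) : ∃ e : E ≃ₗᵢ[ℝ] F, e x = y := by
  let e := (stdOrthonormalBasis ℝ E).equiv (stdOrthonormalBasis ℝ F) (finCongr h)
  refine ⟨e.trans (Submodule.reflection (ℝ ∙ (e x - y))ᗮ), ?_⟩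
  simpa using Submodule.reflection_sub (v := e x) (w := y) (by simpa using hxy)

variable [MeasurableSpace E] [BorelSpace E] [MeasurableSpace F] [BorelSpace F]

theorem lintegral_inner_norm_eq {y : E} (hy : ‖y‖ = 1)
    (h : Module.finrank ℝ E = Module.finrank ℝ F + 1) {g : ℝ × ℝ → ℝ≥0∞} (hg : Measurable g) :
    ∫⁻ x : E, g (⟪y, x⟫, ‖x‖) = ∫⁻ s : ℝ, ∫⁻ w : F, g (s, √(s ^ 2 + ‖w‖ ^ 2)) := by
  obtain ⟨e, he⟩ := exists_linearIsometryEquiv_apply_eq (x := y)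
    (y := WithLp.toLp 2 ((1 : ℝ), (0 : F))) (by simp [hy])
    (by rw [h, (WithLp.linearEquiv 2 ℝ (ℝ × F)).finrank_eq]; simp [add_comm])
  have hmp := (WithLp.volume_preserving_ofLp ℝ F).comp e.measurePreserving
  have hm : Measurable fun p : ℝ × F ↦ g (p.1, √(p.1 ^ 2 + ‖p.2‖ ^ 2)) := by fun_prop
  rw [← lintegral_prod _ hm.aemeasurable, ← Measure.volume_eq_prod, ← hmp.lintegral_comp hm]
  refine lintegral_congr fun x ↦ ?_
  have h1 : ⟪y, x⟫ = (e x).fst := by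
    rw [← e.inner_map_map, he, WithLp.prod_inner_apply]
    simp
  have h2 : ‖x‖ = √((e x).fst ^ 2 + ‖(e x).snd‖ ^ 2) := by
    rw [← e.norm_map, WithLp.prod_norm_eq_of_L2]
    simp
  rw [h1, h2]
  rfl

end Axis

section Cone

theorem lintegral_Ioi_comp_mul_left (h : ℝ → ℝ≥0∞) {s : ℝ} (hs : 0 < s) :
    ∫⁻ r in Ioi (0 : ℝ), h r = ∫⁻ u in Ioi (0 : ℝ), ENNReal.ofReal s * h (s * u) := by
  have := lintegral_image_eq_lintegral_abs_deriv_mul (f := fun u ↦ s * u) (f' := fun _ ↦ s)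
    measurableSet_Ioi (fun x _ ↦ by simpa using ((hasDerivAt_id x).const_mul s).hasDerivWithinAt)
    (mul_right_injective₀ hs.ne').injOn h (s := Ioi (0 : ℝ))
  rwa [image_mul_left_Ioi hs, mul_zero, abs_of_pos hs] at this

theorem lintegral_pow_mul_exp_neg_mul_sq (m : ℕ) {b : ℝ} (hb : 0 < b) :
    ∫⁻ s in Ioi (0 : ℝ), ENNReal.ofReal (s ^ m * Real.exp (-b * s ^ 2)) =
      ENNReal.ofReal (Real.Gamma ((m + 1) / 2) / 2) *
        ENNReal.ofReal (b ^ (-((m : ℝ) + 1) / 2)) := by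
  have hm : (-1 : ℝ) < m := by linarith [m.cast_nonneg (α := ℝ)]
  have hG : 0 ≤ Real.Gamma (((m : ℝ) + 1) / 2) := Real.Gamma_nonneg_of_nonneg (by positivity)
  have hi := integrableOn_rpow_mul_exp_neg_mul_sq hb hm
  have hv := integral_rpow_mul_exp_neg_mul_rpow two_pos hm hb
  simp only [Real.rpow_natCast, Real.rpow_two] at hi hv
  rw [← ofReal_integral_eq_lintegral_ofReal hi, hv, ← ENNReal.ofReal_mul (by positivity)]
  · congr 1
    ring
  · filter_upwards [ae_restrict_mem measurableSet_Ioi] with s hs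
    have : (0 : ℝ) < s := hs
    simp only [Pi.zero_apply]
    positivity

/-- The density, in the slope coordinate `u = ‖w‖ / s`, of the solid angle of a rotationally
symmetric cone in `ℝ^(m+2)`. -/
noncomputable def slopeDensity (m : ℕ) (u : ℝ) : ℝ :=
  u ^ m * (1 + u ^ 2) ^ (-((m : ℝ) + 2) / 2)

theorem lintegral_slope (m : ℕ) {T : Set ℝ} (hT : MeasurableSet T) :
    ∫⁻ s in Ioi (0 : ℝ), ∫⁻ r in Ioi (0 : ℝ), ENNReal.ofReal (r ^ m) *
      T.indicator (fun _ ↦ ENNReal.ofReal (Real.exp (-√(s ^ 2 + r ^ 2) ^ 2)))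
        (√(s ^ 2 + r ^ 2) / s) =
    ENNReal.ofReal (Real.Gamma ((m + 2) / 2) / 2) *
      ∫⁻ u in Ioi (0 : ℝ) ∩ {u | √(1 + u ^ 2) ∈ T}, ENNReal.ofReal (slopeDensity m u) := by
  have hS : MeasurableSet {u : ℝ | √(1 + u ^ 2) ∈ T} :=
    (show Measurable fun u : ℝ ↦ √(1 + u ^ 2) by fun_prop) hT
  have hF : Measurable fun p : ℝ × ℝ ↦ {u : ℝ | √(1 + u ^ 2) ∈ T}.indicator
      (fun u ↦ ENNReal.ofReal (u ^ m) *
        ENNReal.ofReal (p.1 ^ (m + 1) * Real.exp (-(1 + u ^ 2) * p.1 ^ 2))) p.2 := by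
    have : Measurable fun p : ℝ × ℝ ↦ ENNReal.ofReal (p.2 ^ m) *
        ENNReal.ofReal (p.1 ^ (m + 1) * Real.exp (-(1 + p.2 ^ 2) * p.1 ^ 2)) := by fun_prop
    exact this.indicator (measurable_snd hS)
  calc
    _ = ∫⁻ s in Ioi (0 : ℝ), ∫⁻ u in Ioi (0 : ℝ), {u : ℝ | √(1 + u ^ 2) ∈ T}.indicator
          (fun u ↦ ENNReal.ofReal (u ^ m) *
            ENNReal.ofReal (s ^ (m + 1) * Real.exp (-(1 + u ^ 2) * s ^ 2))) u := by
      refine setLIntegral_congr_fun measurableSet_Ioi fun s (hs : 0 < s) ↦ ?_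
      rw [lintegral_Ioi_comp_mul_left _ hs]
      refine setLIntegral_congr_fun measurableSet_Ioi fun u (hu : 0 < u) ↦ ?_
      have hsq : s ^ 2 + (s * u) ^ 2 = s ^ 2 * (1 + u ^ 2) := by ring
      have hsqrt : √(s ^ 2 + (s * u) ^ 2) = s * √(1 + u ^ 2) := by
        rw [hsq, Real.sqrt_mul (by positivity), Real.sqrt_sq hs.le]
      have hexp : (s * √(1 + u ^ 2)) ^ 2 = (1 + u ^ 2) * s ^ 2 := by
        rw [mul_pow, Real.sq_sqrt (by positivity), mul_comm]
      classical
      simp only [hsqrt, mul_div_cancel_left₀ _ hs.ne', hexp, indicator_apply, mem_ofPred_eq]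
      split_ifs
      · rw [← ENNReal.ofReal_mul (by positivity), ← ENNReal.ofReal_mul (by positivity),
          ← ENNReal.ofReal_mul (by positivity)]
        congr 1
        ring_nf
      · simp
    _ = ∫⁻ u in Ioi (0 : ℝ), ∫⁻ s in Ioi (0 : ℝ), {u : ℝ | √(1 + u ^ 2) ∈ T}.indicator
          (fun u ↦ ENNReal.ofReal (u ^ m) *
            ENNReal.ofReal (s ^ (m + 1) * Real.exp (-(1 + u ^ 2) * s ^ 2))) u :=
      lintegral_lintegral_swap hF.aemeasurable
    _ = ∫⁻ u in Ioi (0 : ℝ), {u : ℝ | √(1 + u ^ 2) ∈ T}.indicator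
          (fun u ↦ ENNReal.ofReal (Real.Gamma ((m + 2) / 2) / 2) *
            ENNReal.ofReal (slopeDensity m u)) u := by
      refine setLIntegral_congr_fun measurableSet_Ioi fun u (hu : 0 < u) ↦ ?_
      classical
      simp only [indicator_apply]
      split_ifs
      · rw [lintegral_const_mul' _ _ ENNReal.ofReal_ne_top,
          lintegral_pow_mul_exp_neg_mul_sq _ (by positivity), slopeDensity,
          ENNReal.ofReal_mul (by positivity)]
        push_cast
        rw [show (m : ℝ) + 1 + 1 = m + 2 by ring]
        ring
      · simp
    _ = _ := by
      rw [setLIntegral_indicator hS, lintegral_const_mul' _ _ ENNReal.ofReal_ne_top, inter_comm]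

variable {E : Type*} [NormedAddCommGroup E] [InnerProductSpace ℝ E]

/-- The open half-space cone around `y` of vectors whose secant with `y` lies in `T`. -/
def secantCone (T : Set ℝ) (y : E) : Set E := {x | 0 < ⟪y, x⟫ ∧ ‖x‖ / ⟪y, x⟫ ∈ T}

variable [FiniteDimensional ℝ E] [MeasurableSpace E] [BorelSpace E]

theorem measurableSet_secantCone {T : Set ℝ} (hT : MeasurableSet T) (y : E) :
    MeasurableSet (secantCone T y) := by
  have h : MeasurableSet {x : E | 0 < ⟪y, x⟫} := measurableSet_lt (by fun_prop) (by fun_prop)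
  exact h.inter ((show Measurable fun x : E ↦ ‖x‖ / ⟪y, x⟫ by fun_prop) hT)

theorem exists_lintegral_exp_neg_norm_sq_secantCone {m : ℕ} (h : Module.finrank ℝ E = m + 2) :
    ∃ c : ℝ≥0∞, c ≠ 0 ∧ c ≠ ∞ ∧ ∀ T : Set ℝ, MeasurableSet T → ∀ y : E, ‖y‖ = 1 →
      ∫⁻ x in secantCone T y, ENNReal.ofReal (Real.exp (-‖x‖ ^ 2)) =
        c * ∫⁻ u in Ioi (0 : ℝ) ∩ {u | √(1 + u ^ 2) ∈ T}, ENNReal.ofReal (slopeDensity m u) := by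
  let F := EuclideanSpace ℝ (Fin (m + 1))
  have hF : Module.finrank ℝ F = m + 1 := finrank_euclideanSpace_fin
  have hG : 0 < Real.Gamma (((m : ℝ) + 2) / 2) := Real.Gamma_pos_of_pos (by positivity)
  refine ⟨(volume : Measure F).toSphere univ * ENNReal.ofReal (Real.Gamma ((m + 2) / 2) / 2),
    mul_ne_zero ((Measure.measure_univ_ne_zero).2 (Measure.toSphere_ne_zero _)) (by simpa using hG),
    ENNReal.mul_ne_top (measure_ne_top _ _) ENNReal.ofReal_ne_top, fun T hT y hy ↦ ?_⟩
  let g : ℝ × ℝ → ℝ≥0∞ := {p : ℝ × ℝ | 0 < p.1 ∧ p.2 / p.1 ∈ T}.indicator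
    fun p ↦ ENNReal.ofReal (Real.exp (-p.2 ^ 2))
  have hg : Measurable g := by
    have h : MeasurableSet {p : ℝ × ℝ | 0 < p.1} := measurableSet_lt (by fun_prop) (by fun_prop)
    exact Measurable.indicator (by fun_prop) <| h.inter <|
      ((show Measurable fun p : ℝ × ℝ ↦ p.2 / p.1 by fun_prop) hT)
  calc
    _ = ∫⁻ x : E, g (⟪y, x⟫, ‖x‖) := by
      rw [← lintegral_indicator (measurableSet_secantCone hT y)]
      rfl
    _ = ∫⁻ s : ℝ, ∫⁻ w : F, g (s, √(s ^ 2 + ‖w‖ ^ 2)) :=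
      lintegral_inner_norm_eq hy (by rw [h, hF]) hg
    _ = ∫⁻ s : ℝ, (volume : Measure F).toSphere univ *
          ∫⁻ r in Ioi (0 : ℝ), ENNReal.ofReal (r ^ m) * g (s, √(s ^ 2 + r ^ 2)) := by
      refine lintegral_congr fun s ↦ ?_
      rw [lintegral_fun_norm_addHaar volume (f := fun r ↦ g (s, √(s ^ 2 + r ^ 2))) (by fun_prop),
        hF, Nat.add_sub_cancel]
    _ = ∫⁻ s : ℝ, (Ioi (0 : ℝ)).indicator (fun s ↦ (volume : Measure F).toSphere univ *
          ∫⁻ r in Ioi (0 : ℝ), ENNReal.ofReal (r ^ m) *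
            T.indicator (fun _ ↦ ENNReal.ofReal (Real.exp (-√(s ^ 2 + r ^ 2) ^ 2)))
              (√(s ^ 2 + r ^ 2) / s)) s := by
      refine lintegral_congr fun s ↦ ?_
      classical
      by_cases hs : 0 < s <;> simp [g, indicator_apply, hs]
    _ = _ := by
      rw [lintegral_indicator measurableSet_Ioi, lintegral_const_mul' _ _ (measure_ne_top _ _),
        lintegral_slope m hT, mul_assoc]

end Cone

section Beta

/-- The integrand of `incBeta x ((m + 1) / 2) (1 / 2)`. -/
noncomputable def betaDensity (m : ℕ) (t : ℝ) : ℝ :=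
  t ^ (((m : ℝ) + 1) / 2 - 1) * (1 - t) ^ ((1 : ℝ) / 2 - 1)

theorem incBeta_eq_toReal_lintegral (m : ℕ) {b : ℝ} (hb₀ : 0 ≤ b) (hb₁ : b ≤ 1) :
    incBeta b (((m : ℝ) + 1) / 2) (1 / 2) =
      (∫⁻ t in Ioo (0 : ℝ) 1 ∩ Iic b, ENNReal.ofReal (betaDensity m t)).toReal := by
  have hIoc : (Ioo (0 : ℝ) 1 ∩ Iic b : Set ℝ) =ᵐ[volume] (Ioc 0 b : Set ℝ) := by
    have : Ioc (0 : ℝ) 1 ∩ Iic b = Ioc 0 b := by rw [Ioc_inter_Iic, min_eq_right hb₁]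
    exact this ▸ Ioo_ae_eq_Ioc.inter (ae_eq_refl _)
  rw [setLIntegral_congr hIoc, incBeta, intervalIntegral.integral_of_le hb₀]
  refine integral_eq_lintegral_of_nonneg_ae ?_ (by fun_prop)
  filter_upwards [ae_restrict_mem measurableSet_Ioc] with t ht
  have := ht.1.le
  have : 0 ≤ 1 - t := by linarith [ht.2]
  simp only [Pi.zero_apply]
  positivity

theorem slopeDensity_eq (m : ℕ) {u : ℝ} (hu : 0 < u) :
    2 * u / (1 + u ^ 2) ^ 2 * betaDensity m (1 - (1 + u ^ 2)⁻¹) = 2 * slopeDensity m u := by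
  have hq : 0 < 1 + u ^ 2 := by positivity
  have h1 : 1 - (1 + u ^ 2)⁻¹ = u ^ (2 : ℝ) * (1 + u ^ 2) ^ (-1 : ℝ) := by
    rw [Real.rpow_two, Real.rpow_neg_one]
    field_simp
    ring
  have h2 : (1 - (1 - (1 + u ^ 2)⁻¹)) = (1 + u ^ 2) ^ (-1 : ℝ) := by
    rw [Real.rpow_neg_one]
    ring
  have h3 : 2 * u / (1 + u ^ 2) ^ 2 = 2 * (u ^ (1 : ℝ) * (1 + u ^ 2) ^ (-2 : ℝ)) := by
    rw [Real.rpow_one, Real.rpow_neg hq.le, Real.rpow_two]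
    ring
  rw [betaDensity, slopeDensity, h2, h1, h3, Real.mul_rpow (by positivity) (by positivity),
    ← Real.rpow_mul hu.le, ← Real.rpow_mul hq.le, ← Real.rpow_mul hq.le, ← Real.rpow_natCast u m]
  generalize 1 + u ^ 2 = q at hq
  rw [show (m : ℝ) = 1 + 2 * (((m : ℝ) + 1) / 2 - 1) by ring, Real.rpow_add hu,
    show -(1 + 2 * (((m : ℝ) + 1) / 2 - 1) + 2) / 2 =
      -2 + (-1 * (((m : ℝ) + 1) / 2 - 1) + -1 * (1 / 2 - 1)) by ring,
    Real.rpow_add hq, Real.rpow_add hq]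
  ring_nf

theorem two_mul_lintegral_slopeDensity (m : ℕ) {B : Set ℝ} (hB : MeasurableSet B) :
    2 * ∫⁻ u in Ioi (0 : ℝ) ∩ {u | 1 - (1 + u ^ 2)⁻¹ ∈ B}, ENNReal.ofReal (slopeDensity m u) =
      ∫⁻ t in Ioo (0 : ℝ) 1 ∩ B, ENNReal.ofReal (betaDensity m t) := by
  have himage : (fun u : ℝ ↦ 1 - (1 + u ^ 2)⁻¹) '' (Ioi 0 ∩ {u | 1 - (1 + u ^ 2)⁻¹ ∈ B}) =
      Ioo 0 1 ∩ B := by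
    ext t
    constructor
    · rintro ⟨u, ⟨hu : 0 < u, huB⟩, rfl⟩
      have h1 : (1 + u ^ 2)⁻¹ < 1 := inv_lt_one_of_one_lt₀ (by nlinarith)
      have h0 : 0 < (1 + u ^ 2)⁻¹ := by positivity
      exact ⟨⟨by linarith, by linarith⟩, huB⟩
    · rintro ⟨⟨h0, h1⟩, ht⟩
      have h1' : 0 < 1 - t := by linarith
      have hu : 1 - (1 + √(t / (1 - t)) ^ 2)⁻¹ = t := by
        rw [Real.sq_sqrt (by positivity)]
        field_simp
        ring
      exact ⟨√(t / (1 - t)), ⟨Real.sqrt_pos.2 (by positivity), by simpa [hu] using ht⟩, hu⟩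
  have hmeas : MeasurableSet (Ioi (0 : ℝ) ∩ {u | 1 - (1 + u ^ 2)⁻¹ ∈ B}) :=
    measurableSet_Ioi.inter ((show Measurable fun u : ℝ ↦ 1 - (1 + u ^ 2)⁻¹ by fun_prop) hB)
  have hderiv (u : ℝ) :
      HasDerivAt (fun u : ℝ ↦ 1 - (1 + u ^ 2)⁻¹) (2 * u / (1 + u ^ 2) ^ 2) u := by
    have hq : 1 + u ^ 2 ≠ 0 := by positivity
    convert! (((hasDerivAt_pow 2 u).const_add 1).inv hq).const_sub 1 using 1
    simp
    ring
  have hinj : InjOn (fun u : ℝ ↦ 1 - (1 + u ^ 2)⁻¹)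
      (Ioi 0 ∩ {u | 1 - (1 + u ^ 2)⁻¹ ∈ B}) := by
    rintro u ⟨hu : 0 < u, -⟩ v ⟨hv : 0 < v, -⟩ huv
    have : u ^ 2 = v ^ 2 := by simpa using huv
    exact (pow_left_inj₀ hu.le hv.le two_ne_zero).1 this
  rw [← himage, lintegral_image_eq_lintegral_abs_deriv_mul hmeas
    (fun u _ ↦ (hderiv u).hasDerivWithinAt) hinj, ← lintegral_const_mul' _ _ (by simp)]
  refine setLIntegral_congr_fun hmeas fun u ⟨(hu : 0 < u), _⟩ ↦ ?_
  rw [abs_of_pos (by positivity), ← ENNReal.ofReal_mul (by positivity), slopeDensity_eq m hu,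
    ENNReal.ofReal_mul two_pos.le, ENNReal.ofReal_ofNat]

end Beta

section Cover

variable {E : Type*} [NormedAddCommGroup E] [InnerProductSpace ℝ E]

theorem dist_sq_eq_of_norm_eq_one {x y : E} (hx : ‖x‖ = 1) (hy : ‖y‖ = 1) :
    dist x y ^ 2 = 2 - 2 * ⟪x, y⟫ := by
  rw [dist_eq_norm, norm_sub_sq_real, hx, hy]
  ring

variable (E) in
theorem exists_finset_norm_eq_one_inner_le_half [FiniteDimensional ℝ E] :
    ∃ C : Finset E, (∀ x ∈ C, ‖x‖ = 1) ∧ (∀ x ∈ C, ∀ y ∈ C, x ≠ y → ⟪x, y⟫ ≤ 1 / 2) ∧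
      ∀ x : E, ‖x‖ = 1 → ∃ y ∈ C, 1 / 2 ≤ ⟪y, x⟫ := by
  have hp : packingNumber 1 (sphere (0 : E) 1) ≠ ⊤ := by
    obtain ⟨N, -, hN, hcover⟩ := exists_finite_isCover_of_isCompact (ε := 1 / 2) (by simp)
      (isCompact_sphere (0 : E) 1)
    have h := (packingNumber_two_mul_le_externalCoveringNumber (1 / 2) (sphere (0 : E) 1)).trans
      hcover.externalCoveringNumber_le_encard
    rw [show (2 : ℝ≥0) * (1 / 2) = 1 by norm_num] at h
    exact (h.trans_lt hN.encard_lt_top).ne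
  have hfin : (maximalSeparatedSet 1 (sphere (0 : E) 1)).Finite := by
    rw [← encard_ne_top_iff, encard_maximalSeparatedSet hp]
    exact hp
  have hnorm {x : E} (hx : x ∈ maximalSeparatedSet 1 (sphere (0 : E) 1)) : ‖x‖ = 1 := by
    simpa using maximalSeparatedSet_subset hx
  refine ⟨hfin.toFinset, fun x hx ↦ hnorm (by simpa using hx), fun x hx y hy hxy ↦ ?_,
    fun x hx ↦ ?_⟩
  · rw [Finite.mem_toFinset] at hx hy
    have h : 1 < dist x y := by
      have h : 1 < edist x y := isSeparated_maximalSeparatedSet hx hy hxy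
      rw [edist_dist] at h
      simpa using h
    nlinarith [dist_sq_eq_of_norm_eq_one (hnorm hx) (hnorm hy)]
  · obtain ⟨y, hy, hxy⟩ := isCover_maximalSeparatedSet hp (show x ∈ sphere (0 : E) 1 by simpa)
    refine ⟨y, by simpa using hy, ?_⟩
    have h : dist y x ≤ 1 := by
      rw [dist_comm]
      have h : edist x y ≤ 1 := by simpa using hxy
      rw [edist_dist] at h
      simpa using h
    nlinarith [dist_sq_eq_of_norm_eq_one (hnorm hy) hx, dist_nonneg (x := y) (y := x)]

end Cover

section Bound

variable {E : Type*} [NormedAddCommGroup E] [InnerProductSpace ℝ E]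

/-- The vectors `x` in the half-space of `y` such that the squared sine of the angle between
`x` and `y` is at most `b`, when `y` is a unit vector. -/
def sineCone (b : ℝ) (y : E) : Set E := secantCone {v | 1 - (v ^ 2)⁻¹ ∈ Iic b} y

theorem mem_sineCone_of_half_le {x y : E} (hx : x ≠ 0) (h : 1 / 2 ≤ ⟪y, ‖x‖⁻¹ • x⟫) :
    x ∈ sineCone (3 / 4) y := by
  have hx' : 0 < ‖x‖ := norm_pos_iff.2 hx
  rw [inner_smul_right, ← div_eq_inv_mul, le_div_iff₀ hx'] at h
  have hyx : 0 < ⟪y, x⟫ := by linarith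
  refine ⟨hyx, ?_⟩
  have hle : 1 / 4 ≤ ((‖x‖ / ⟪y, x⟫) ^ 2)⁻¹ := by
    rw [← inv_pow, inv_div, div_pow, le_div_iff₀ (by positivity)]
    nlinarith
  simp only [mem_ofPred_eq, mem_Iic]
  linarith

theorem disjoint_sineCone_neg (b : ℝ) (y : E) : Disjoint (sineCone b y) (sineCone b (-y)) := by
  rw [Set.disjoint_left]
  rintro x ⟨hx, -⟩ ⟨hx', -⟩
  rw [inner_neg_left] at hx'
  linarith

variable [FiniteDimensional ℝ E] [MeasurableSpace E] [BorelSpace E]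

theorem measurableSet_sineCone (b : ℝ) (y : E) : MeasurableSet (sineCone b y) :=
  measurableSet_secantCone
    ((show Measurable fun v : ℝ ↦ 1 - (v ^ 2)⁻¹ by fun_prop) measurableSet_Iic) y

/-- The measure on `E` with density `exp (-‖x‖ ^ 2)`. -/
noncomputable def gaussianWeight (E : Type*) [NormedAddCommGroup E] [InnerProductSpace ℝ E]
    [FiniteDimensional ℝ E] [MeasurableSpace E] [BorelSpace E] : Measure E :=
  volume.withDensity fun x ↦ ENNReal.ofReal (Real.exp (-‖x‖ ^ 2))

theorem gaussianWeight_univ_ne_top [Nontrivial E] : gaussianWeight E univ ≠ ∞ := by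
  rw [gaussianWeight, withDensity_apply _ .univ, setLIntegral_univ,
    lintegral_fun_norm_addHaar volume (f := fun r ↦ ENNReal.ofReal (Real.exp (-r ^ 2)))
      (by fun_prop)]
  refine ENNReal.mul_ne_top (measure_ne_top _ _) ?_
  have h := lintegral_pow_mul_exp_neg_mul_sq (Module.finrank ℝ E - 1) one_pos
  rw [setLIntegral_congr_fun (g := fun r ↦ ENNReal.ofReal (r ^ (Module.finrank ℝ E - 1)) *
    ENNReal.ofReal (Real.exp (-r ^ 2))) measurableSet_Ioi fun r (hr : 0 < r) ↦ ?_] at h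
  · rw [h]
    exact ENNReal.mul_ne_top ENNReal.ofReal_ne_top ENNReal.ofReal_ne_top
  · simp only [← ENNReal.ofReal_mul (pow_nonneg hr.le _), neg_one_mul]

theorem gaussianWeight_singleton_zero [Nontrivial E] : gaussianWeight E {0} = 0 :=
  withDensity_absolutelyContinuous _ _ (measure_singleton 0)

theorem exists_two_mul_gaussianWeight_sineCone {m : ℕ} (h : Module.finrank ℝ E = m + 2) :
    ∃ c : ℝ≥0∞, c ≠ 0 ∧ c ≠ ∞ ∧ ∀ (b : ℝ) (y : E), ‖y‖ = 1 →
      2 * gaussianWeight E (sineCone b y) =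
        c * ∫⁻ t in Ioo (0 : ℝ) 1 ∩ Iic b, ENNReal.ofReal (betaDensity m t) := by
  obtain ⟨c, hc₀, hc, H⟩ := exists_lintegral_exp_neg_norm_sq_secantCone h
  refine ⟨c, hc₀, hc, fun b y hy ↦ ?_⟩
  rw [gaussianWeight, withDensity_apply _ (measurableSet_sineCone b y), sineCone, H _ ?_ y hy,
    mul_left_comm, ← two_mul_lintegral_slopeDensity m measurableSet_Iic]
  · have hsq (u : ℝ) : √(1 + u ^ 2) ^ 2 = 1 + u ^ 2 := Real.sq_sqrt (by positivity)
    simp only [mem_ofPred_eq, hsq]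
  · exact (show Measurable fun v : ℝ ↦ 1 - (v ^ 2)⁻¹ by fun_prop) measurableSet_Iic

theorem two_mul_incBeta_div_le_card {m : ℕ} (h : Module.finrank ℝ E = m + 2) {C : Finset E}
    (hC : ∀ x ∈ C, ‖x‖ = 1) (hcover : ∀ x : E, ‖x‖ = 1 → ∃ y ∈ C, 1 / 2 ≤ ⟪y, x⟫) :
    2 * incBeta 1 (((m : ℝ) + 1) / 2) (1 / 2) / incBeta (3 / 4) (((m : ℝ) + 1) / 2) (1 / 2) ≤
      C.card := by
  have : Nontrivial E := Module.nontrivial_of_finrank_pos (R := ℝ) (by omega)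
  obtain ⟨c, hc₀, hc, H⟩ := exists_two_mul_gaussianWeight_sineCone h
  obtain ⟨y, hy⟩ := exists_norm_eq E zero_le_one
  rw [incBeta_eq_toReal_lintegral m zero_le_one le_rfl,
    incBeta_eq_toReal_lintegral m (b := 3 / 4) (by norm_num) (by norm_num)]
  set J : ℝ → ℝ≥0∞ := fun b ↦
    ∫⁻ t in Ioo (0 : ℝ) 1 ∩ Iic b, ENNReal.ofReal (betaDensity m t)
  have hlower : gaussianWeight E (sineCone 1 y) + gaussianWeight E (sineCone 1 (-y)) ≤
      gaussianWeight E univ := by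
    rw [← measure_union (disjoint_sineCone_neg 1 y) (measurableSet_sineCone 1 _)]
    exact measure_mono (subset_univ _)
  have hupper : gaussianWeight E univ ≤ ∑ z ∈ C, gaussianWeight E (sineCone (3 / 4) z) := by
    have hsub : (univ : Set E) ⊆ {0} ∪ ⋃ z ∈ C, sineCone (3 / 4) z := by
      intro x _
      by_cases hx : x = 0
      · exact .inl hx
      · obtain ⟨z, hz, hzx⟩ := hcover (‖x‖⁻¹ • x) (norm_smul_inv_norm hx)
        exact .inr (mem_biUnion hz (mem_sineCone_of_half_le hx hzx))
    calc
      _ ≤ _ := measure_mono hsub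
      _ ≤ _ := measure_union_le _ _
      _ ≤ _ := by
        rw [gaussianWeight_singleton_zero, zero_add]
        exact measure_biUnion_finset_le _ _
  have hle : c * (2 * J 1) ≤ c * (C.card * J (3 / 4)) := by
    calc
      c * (2 * J 1) = 2 * (gaussianWeight E (sineCone 1 y) +
          gaussianWeight E (sineCone 1 (-y))) := by
        rw [mul_add, H 1 y hy, H 1 (-y) (by rwa [norm_neg])]
        ring
      _ ≤ 2 * ∑ z ∈ C, gaussianWeight E (sineCone (3 / 4) z) := by
        gcongr
        exact hlower.trans hupper
      _ = c * (C.card * J (3 / 4)) := by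
        rw [Finset.mul_sum, Finset.sum_congr rfl fun z hz ↦ H (3 / 4) z (hC z hz),
          Finset.sum_const, nsmul_eq_mul]
        ring
  have hfin (b : ℝ) : J b ≠ ∞ := by
    have hlt : c * J b < ∞ := by
      rw [← H b y hy]
      exact ENNReal.mul_lt_top (by simp)
        ((measure_mono (subset_univ _)).trans_lt gaussianWeight_univ_ne_top.lt_top)
    exact fun h ↦ by simp [h, hc₀] at hlt
  have hreal := ENNReal.toReal_mono (ENNReal.mul_ne_top (by simp) (hfin _))
    ((ENNReal.mul_le_mul_iff_right hc₀ hc).1 hle)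
  rw [ENNReal.toReal_mul, ENNReal.toReal_mul] at hreal
  exact div_le_of_le_mul₀ ENNReal.toReal_nonneg (Nat.cast_nonneg _) (by simpa using hreal)

end Bound

/-- Corollary 2.5, lower-bound half: lower bound on the Euclidean kissing number. -/
theorem lower_bound_euclidean_kissing (n : ℕ) (hn : 2 ≤ n) :
    ∃ C : Finset (EuclideanSpace ℝ (Fin n)),
      IsSphericalCode n (1 / 2) C ∧
      2 * incBeta 1 ((n - 1) / 2) (1 / 2) / incBeta (3 / 4) ((n - 1) / 2) (1 / 2)
        ≤ (C.card : ℝ) := by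
  obtain ⟨m, rfl⟩ := Nat.exists_eq_add_of_le' hn
  obtain ⟨C, hnorm, hinner, hcover⟩ :=
    exists_finset_norm_eq_one_inner_le_half (EuclideanSpace ℝ (Fin (m + 2)))
  refine ⟨C, ⟨hnorm, hinner⟩, ?_⟩
  have h := two_mul_incBeta_div_le_card finrank_euclideanSpace_fin hnorm hcover
  rwa [show (((m + 2 : ℕ) : ℝ) - 1) / 2 = ((m : ℝ) + 1) / 2 by push_cast; ring]
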